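/- arXiv:1302.1017 — 5 statements merged into one kernel-verified Lean document; each statement's English description precedes it below -/
import Mathlib

section
/- Let r ≥ 1/8 and let (Y₁,Y₂,Y₃) be a centered Gaussian random vector in ℝ³ with covariance matrix Σ(r). Then for every u ∈ ℝ, E|(Y₁ − u)(Y₃ − u) − Y₂²| = u² − 1 + 2·(8r)^{3/2}·exp(−u²/(24r − 2))/√(24r − 2). -/
open MeasureTheory ProbabilityTheory Real

/-- The law of three real random variables, all of whose linear combinations are centered
Gaussian with the variance of independent summands, is a product of Gaussian laws. -/
lemma map_eq_prod_gaussianReal {Ω : Type*} [MeasurableSpace Ω] {P : Measure Ω}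
    [IsProbabilityMeasure P] {X Y Z : Ω → ℝ} (hX : Measurable X) (hY : Measurable Y)
    (hZ : Measurable Z) {s v w : NNReal}
    (h : ∀ a b c : ℝ, P.map (fun ω => a * X ω + b * Y ω + c * Z ω) =
      gaussianReal 0 (s * a ^ 2 + v * b ^ 2 + w * c ^ 2 : ℝ).toNNReal) :
    P.map (fun ω => (X ω, Y ω, Z ω)) =
      (gaussianReal 0 s).prod ((gaussianReal 0 v).prod (gaussianReal 0 w)) := by
  have : IsProbabilityMeasure (P.map (fun ω => (X ω, Y ω, Z ω))) :=
    Measure.isProbabilityMeasure_map (by fun_prop)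
  refine Measure.ext_of_charFunDual (funext fun L => ?_)
  have hL : ∀ x y z : ℝ, L (x, y, z) = L (1, 0, 0) * x + L (0, 1, 0) * y + L (0, 0, 1) * z := by
    intro x y z
    have : (x, y, z) = x • ((1, 0, 0) : ℝ × ℝ × ℝ) + y • ((0, 1, 0) : ℝ × ℝ × ℝ)
        + z • ((0, 0, 1) : ℝ × ℝ × ℝ) := by simp
    rw [this]
    simp only [map_add, map_smul, smul_eq_mul]
    ring
  rw [charFunDual_prod, charFunDual_prod]
  simp only [charFunDual_eq_charFun_map_one, gaussianReal_map_continuousLinearMap]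
  rw [Measure.map_map (by fun_prop) (by fun_prop)]
  have hcomp : (⇑L ∘ fun ω => (X ω, Y ω, Z ω)) =
      fun ω => L (1, 0, 0) * X ω + L (0, 1, 0) * Y ω + L (0, 0, 1) * Z ω :=
    funext fun ω => hL _ _ _
  rw [hcomp, h]
  simp only [charFun_gaussianReal, ← Complex.exp_add]
  congr 1
  have h0 : (0 : ℝ) ≤ s * L (1, 0, 0) ^ 2 + v * L (0, 1, 0) ^ 2 + w * L (0, 0, 1) ^ 2 := by
    positivity
  have h00 : ((1 : ℝ), (0 : ℝ × ℝ)) = (1, 0, 0) := rfl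
  simp only [map_zero, NNReal.coe_mul, Real.coe_toNNReal _ h0, Real.coe_toNNReal _ (sq_nonneg _),
    ContinuousLinearMap.comp_apply, ContinuousLinearMap.inl_apply, ContinuousLinearMap.inr_apply,
    h00]
  push_cast
  ring

lemma integral_prod_gaussianReal {s v : NNReal} (hs : s ≠ 0) (hv : v ≠ 0) (f : ℝ × ℝ → ℝ) :
    ∫ p, f p ∂((gaussianReal 0 s).prod (gaussianReal 0 v)) =
      ∫ p, gaussianPDFReal 0 s p.1 * gaussianPDFReal 0 v p.2 * f p := by
  rw [gaussianReal_of_var_ne_zero _ hs, gaussianReal_of_var_ne_zero _ hv,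
    prod_withDensity (measurable_gaussianPDF _ _) (measurable_gaussianPDF _ _),
    integral_withDensity_eq_integral_toReal_smul]
  · simp [Measure.volume_eq_prod]
  · exact ((measurable_gaussianPDF _ _).comp measurable_fst).mul
      ((measurable_gaussianPDF _ _).comp measurable_snd)
  · exact ae_of_all _ fun p => ENNReal.mul_lt_top gaussianPDF_lt_top gaussianPDF_lt_top

/-- A rotation-invariant function of two independent Gaussian variables of variance `v` is
integrated against the Rayleigh density. -/
lemma integral_gaussianReal_prod_sq_add_sq {v : NNReal} (hv : v ≠ 0) (f : ℝ → ℝ) :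
    ∫ p, f (p.1 ^ 2 + p.2 ^ 2) ∂((gaussianReal 0 v).prod (gaussianReal 0 v)) =
      ∫ t in Set.Ioi (0 : ℝ), f (t ^ 2) * (t / v * exp (-t ^ 2 / (2 * v))) := by
  have hv' : (0 : ℝ) < v := by positivity
  rw [integral_prod_gaussianReal hv hv, ← integral_comp_polarCoord_symm]
  have key : ∀ p : ℝ × ℝ, p.1 • (gaussianPDFReal 0 v (polarCoord.symm p).1 *
      gaussianPDFReal 0 v (polarCoord.symm p).2 *
        f ((polarCoord.symm p).1 ^ 2 + (polarCoord.symm p).2 ^ 2)) =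
      (f (p.1 ^ 2) * (p.1 / v * exp (-p.1 ^ 2 / (2 * v)))) * (2 * π)⁻¹ := by
    rintro ⟨t, θ⟩
    have hsq : (t * cos θ) ^ 2 + (t * sin θ) ^ 2 = t ^ 2 := by
      linear_combination t ^ 2 * sin_sq_add_cos_sq θ
    have hexp : exp (-(t * cos θ) ^ 2 / (2 * v)) * exp (-(t * sin θ) ^ 2 / (2 * v)) =
        exp (-t ^ 2 / (2 * v)) := by
      rw [← exp_add, ← hsq]
      congr 1
      ring
    have hsqrt : (√(2 * π * v))⁻¹ * (√(2 * π * v))⁻¹ = (2 * π * v)⁻¹ := by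
      rw [← mul_inv, mul_self_sqrt (by positivity)]
    simp only [polarCoord_symm_apply, gaussianPDFReal, sub_zero, hsq, smul_eq_mul]
    calc _ = t * f (t ^ 2) * ((√(2 * π * v))⁻¹ * (√(2 * π * v))⁻¹) *
          (exp (-(t * cos θ) ^ 2 / (2 * v)) * exp (-(t * sin θ) ^ 2 / (2 * v))) := by ring
      _ = _ := by
        rw [hsqrt, hexp]
        field_simp
  simp_rw [key]
  rw [polarCoord_target, Measure.volume_eq_prod,
    setIntegral_prod_mul (fun t : ℝ => f (t ^ 2) * (t / v * exp (-t ^ 2 / (2 * v))))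
      (fun _ : ℝ => (2 * π)⁻¹)]
  have : π - -π = 2 * π := by ring
  simp only [integral_const, MeasurableSet.univ, measureReal_restrict_apply, Set.univ_inter,
    volume_real_Ioo_of_le (neg_le_self pi_pos.le), this, smul_eq_mul]
  rw [mul_inv_cancel₀ (by positivity), mul_one]

lemma integral_abs_sub_rayleigh {v a : ℝ} (hv : 0 < v) (ha : 0 ≤ a) :
    ∫ t in Set.Ioi (0 : ℝ), |a - t ^ 2| * (t / v * exp (-t ^ 2 / (2 * v))) =
      a - 2 * v + 4 * v * exp (-a / (2 * v)) := by
  set G : ℝ → ℝ := fun t => (t ^ 2 - a + 2 * v) * exp (-t ^ 2 / (2 * v)) with hG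
  set g : ℝ → ℝ := fun t => (a - t ^ 2) * (t / v * exp (-t ^ 2 / (2 * v))) with hg
  have hderiv : ∀ t, HasDerivAt G (g t) t := by
    intro t
    have h1 : HasDerivAt (fun t : ℝ => t ^ 2) (2 * t) t := by simpa using hasDerivAt_pow 2 t
    have h2 := ((h1.sub_const a).add_const (2 * v)).mul ((h1.neg.div_const (2 * v)).exp)
    refine h2.congr_deriv ?_
    simp only [hg, Pi.neg_apply]
    field_simp
    ring
  have htend : Filter.Tendsto G Filter.atTop (nhds 0) := by
    have hx : Filter.Tendsto (fun t : ℝ => t ^ 2 / (2 * v)) Filter.atTop Filter.atTop :=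
      (Filter.tendsto_pow_atTop two_ne_zero).atTop_div_const (by positivity)
    have h1 := (tendsto_pow_mul_exp_neg_atTop_nhds_zero 1).comp hx
    have h0 := (tendsto_pow_mul_exp_neg_atTop_nhds_zero 0).comp hx
    have := (h1.const_mul (2 * v)).add (h0.const_mul (2 * v - a))
    simp only [mul_zero, add_zero] at this
    refine this.congr fun t => ?_
    simp only [Function.comp, hG, neg_div]
    field_simp
    ring
  have hsa : √a ^ 2 = a := sq_sqrt ha
  have hGa : G (√a) = 2 * v * exp (-a / (2 * v)) := by simp only [hG, hsa]; ring
  have hG0 : G 0 = 2 * v - a := by simp [hG]; ring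
  have hfar : ∀ t ∈ Set.Ioi (√a), g t ≤ 0 := by
    intro t ht
    have h0 : 0 ≤ t := (sqrt_nonneg a).trans (le_of_lt ht)
    have : a ≤ t ^ 2 := by
      rw [← hsa]
      exact pow_le_pow_left₀ (sqrt_nonneg a) (le_of_lt ht) 2
    exact mul_nonpos_of_nonpos_of_nonneg (by linarith) (by positivity)
  have hint := integrableOn_Ioi_deriv_of_nonpos' (fun t _ => hderiv t) hfar htend
  have hfareq : ∀ t ∈ Set.Ioi (√a), |a - t ^ 2| * (t / v * exp (-t ^ 2 / (2 * v))) = -g t := by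
    intro t ht
    have : a ≤ t ^ 2 := by
      rw [← hsa]
      exact pow_le_pow_left₀ (sqrt_nonneg a) (le_of_lt ht) 2
    rw [abs_of_nonpos (by linarith), hg]
    ring
  have hnear : ∀ t ∈ Set.Ioc 0 (√a),
      |a - t ^ 2| * (t / v * exp (-t ^ 2 / (2 * v))) = g t := by
    intro t ht
    have : t ^ 2 ≤ a := by
      rw [← hsa]
      exact pow_le_pow_left₀ ht.1.le ht.2 2
    rw [abs_of_nonneg (by linarith)]
  have hgc : Continuous g := by fun_prop
  rw [← Set.Ioc_union_Ioi_eq_Ioi (sqrt_nonneg a),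
    setIntegral_union (Set.Ioc_disjoint_Ioi le_rfl) measurableSet_Ioi
      ((hgc.integrableOn_Ioc).congr_fun (fun t ht => (hnear t ht).symm) measurableSet_Ioc)
      (hint.neg.congr_fun (fun t ht => (hfareq t ht).symm) measurableSet_Ioi),
    setIntegral_congr_fun measurableSet_Ioc hnear,
    setIntegral_congr_fun measurableSet_Ioi hfareq, integral_neg,
    integral_Ioi_of_hasDerivAt_of_nonpos' (fun t _ => hderiv t) hfar htend,
    ← intervalIntegral.integral_of_le (sqrt_nonneg a),
    intervalIntegral.integral_eq_sub_of_hasDerivAt (fun t _ => hderiv t)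
      (hgc.intervalIntegrable _ _), hGa, hG0]
  ring

lemma integral_exp_neg_sq_gaussianReal (s : NNReal) {v : ℝ} (hv : 0 < v) (u : ℝ) :
    ∫ x, exp (-(x - u) ^ 2 / (2 * v)) ∂(gaussianReal 0 s) =
      √v / √(s + v) * exp (-u ^ 2 / (2 * (s + v))) := by
  by_cases hs : s = 0
  · have : √v ≠ 0 := by positivity
    simp [hs, this]
  have hs' : (0 : ℝ) < s := by positivity
  rw [integral_gaussianReal_eq_integral_smul hs]
  have key : ∀ x : ℝ, gaussianPDFReal 0 s x • exp (-(x - u) ^ 2 / (2 * v)) =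
      (√(2 * π * s))⁻¹ * exp (-u ^ 2 / (2 * (s + v))) *
        exp (-((s + v) / (2 * s * v)) * (x - s * u / (s + v)) ^ 2) := by
    intro x
    rw [gaussianPDFReal, smul_eq_mul, mul_assoc, mul_assoc (√_)⁻¹, ← exp_add, ← exp_add]
    congr 2
    field_simp
    ring
  simp_rw [key]
  rw [integral_const_mul,
    integral_sub_right_eq_self (fun x : ℝ => exp (-((s + v) / (2 * s * v)) * x ^ 2)),
    integral_gaussian]
  have : π / ((s + v) / (2 * s * v)) = (2 * π * s) * (v / (s + v)) := by field_simp
  rw [this, sqrt_mul (x := 2 * π * s) (by positivity), sqrt_div hv.le]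
  have : √(2 * π * s) ≠ 0 := by positivity
  field_simp

lemma integrable_sub_sq_gaussianReal (s : NNReal) (u : ℝ) :
    Integrable (fun x => (x - u) ^ 2) (gaussianReal 0 s) :=
  ((memLp_id_gaussianReal (μ := 0) (v := s) 2).sub (memLp_const u)).integrable_sq

lemma integral_sub_sq_gaussianReal (s : NNReal) (u : ℝ) :
    ∫ x, (x - u) ^ 2 ∂(gaussianReal 0 s) = s + u ^ 2 := by
  have hid : Integrable (fun x : ℝ => x) (gaussianReal 0 s) :=
    (memLp_id_gaussianReal (μ := 0) (v := s) 1).integrable le_rfl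
  have hsq : Integrable (fun x : ℝ => x ^ 2) (gaussianReal 0 s) :=
    (memLp_id_gaussianReal (μ := 0) (v := s) 2).integrable_sq
  have hvar : ∫ x, x ^ 2 ∂(gaussianReal 0 s) = s := by
    have := variance_fun_id_gaussianReal (μ := 0) (v := s)
    rwa [variance_of_integral_eq_zero (by fun_prop) (by simp)] at this
  have : ∀ x : ℝ, (x - u) ^ 2 = x ^ 2 - 2 * u * x + u ^ 2 := fun x => by ring
  simp_rw [this]
  have hsub : Integrable (fun x : ℝ => x ^ 2 - 2 * u * x) (gaussianReal 0 s) :=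
    hsq.sub (hid.const_mul _)
  rw [integral_add hsub (integrable_const _),
    integral_sub hsq (hid.const_mul _), integral_const_mul, hvar]
  simp

/-- The mean of `|(X - u)² - (Y² + Z²)|` for independent centered Gaussian variables `X`, `Y`, `Z`
of variances `s`, `v`, `v`. -/
lemma integral_abs_sq_sub_sq_add_sq (s : NNReal) {v : NNReal} (hv : v ≠ 0) (u : ℝ) :
    ∫ q, |(q.1 - u) ^ 2 - (q.2.1 ^ 2 + q.2.2 ^ 2)|
      ∂((gaussianReal 0 s).prod ((gaussianReal 0 v).prod (gaussianReal 0 v))) =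
    s + u ^ 2 - 2 * v + 4 * v * (√v / √(s + v) * exp (-u ^ 2 / (2 * (s + v)))) := by
  have hv' : (0 : ℝ) < v := by positivity
  have hsq : Integrable (fun x : ℝ => x ^ 2) (gaussianReal 0 v) := by
    simpa using integrable_sub_sq_gaussianReal v 0
  have hint : Integrable (fun q : ℝ × ℝ × ℝ => |(q.1 - u) ^ 2 - (q.2.1 ^ 2 + q.2.2 ^ 2)|)
      ((gaussianReal 0 s).prod ((gaussianReal 0 v).prod (gaussianReal 0 v))) :=
    (((integrable_sub_sq_gaussianReal s u).comp_fst _).sub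
      (((hsq.comp_fst (gaussianReal 0 v)).add (hsq.comp_snd (gaussianReal 0 v))).comp_snd _)).abs
  have hexp : Integrable (fun x : ℝ => exp (-(x - u) ^ 2 / (2 * v))) (gaussianReal 0 s) := by
    refine Integrable.of_bound (by fun_prop) 1 (ae_of_all _ fun x => ?_)
    rw [norm_of_nonneg (exp_pos _).le, exp_le_one_iff, neg_div]
    exact neg_nonpos.2 (by positivity)
  rw [integral_prod _ hint]
  have hinner : ∀ x : ℝ, ∫ p, |(x - u) ^ 2 - (p.1 ^ 2 + p.2 ^ 2)|
      ∂((gaussianReal 0 v).prod (gaussianReal 0 v)) =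
      (x - u) ^ 2 - 2 * v + 4 * v * exp (-(x - u) ^ 2 / (2 * v)) := fun x => by
    rw [integral_gaussianReal_prod_sq_add_sq hv (fun w => |(x - u) ^ 2 - w|),
      integral_abs_sub_rayleigh hv' (sq_nonneg _)]
  simp_rw [hinner]
  have hsub := integrable_sub_sq_gaussianReal s u
  have hsub' : Integrable (fun x : ℝ => (x - u) ^ 2 - 2 * (v : ℝ)) (gaussianReal 0 s) :=
    hsub.sub (integrable_const _)
  rw [integral_add hsub' (hexp.const_mul _),
    integral_sub hsub (integrable_const _), integral_const_mul (4 * (v : ℝ)),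
    integral_exp_neg_sq_gaussianReal s hv', integral_sub_sq_gaussianReal]
  simp

/-- Theorem 4.1 (Gaussian-vector content): for a centered Gaussian vector `(Y₁, Y₂, Y₃)`
with covariance matrix `Σ(r)` (rows `(12r-1, 0, 4r-1)`, `(0, 4r, 0)`, `(4r-1, 0, 12r-1)`),
characterized by the law of all linear combinations, and `r ≥ 1/8`,
`E|(Y₁-u)(Y₃-u) - Y₂²| = u² - 1 + 2 (8r)^{3/2} exp(-u²/(24r-2)) / √(24r-2)`. -/
theorem record_method_expectation_abs_det
    {Ω : Type*} [MeasureSpace Ω] [IsProbabilityMeasure (ℙ : Measure Ω)]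
    (r : ℝ) (hr : 1 / 8 ≤ r)
    (Y₁ Y₂ Y₃ : Ω → ℝ) (hY₁ : Measurable Y₁) (hY₂ : Measurable Y₂) (hY₃ : Measurable Y₃)
    (hGauss : ∀ t₁ t₂ t₃ : ℝ,
      Measure.map (fun ω => t₁ * Y₁ ω + t₂ * Y₂ ω + t₃ * Y₃ ω) ℙ =
        gaussianReal 0 (Real.toNNReal
          ((12 * r - 1) * t₁ ^ 2 + 4 * r * t₂ ^ 2 + (12 * r - 1) * t₃ ^ 2
            + 2 * (4 * r - 1) * t₁ * t₃)))
    (u : ℝ) :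
    (∫ ω, |(Y₁ ω - u) * (Y₃ ω - u) - (Y₂ ω) ^ 2|) =
      u ^ 2 - 1 + 2 * (8 * r) ^ ((3 : ℝ) / 2) * Real.exp (-u ^ 2 / (24 * r - 2))
        / Real.sqrt (24 * r - 2) := by
  obtain ⟨s, hs⟩ : ∃ s : NNReal, (s : ℝ) = 8 * r - 1 := ⟨⟨8 * r - 1, by linarith⟩, rfl⟩
  obtain ⟨v, hv⟩ : ∃ v : NNReal, (v : ℝ) = 4 * r := ⟨⟨4 * r, by linarith⟩, rfl⟩
  have hr0 : 0 < r := by linarith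
  have hv0 : v ≠ 0 := by
    rintro rfl
    rw [NNReal.coe_zero] at hv
    linarith
  have hlaw : Measure.map (fun ω => ((Y₁ ω + Y₃ ω) / 2, (Y₁ ω - Y₃ ω) / 2, Y₂ ω)) ℙ =
      (gaussianReal 0 s).prod ((gaussianReal 0 v).prod (gaussianReal 0 v)) := by
    refine map_eq_prod_gaussianReal (by fun_prop) (by fun_prop) hY₂ fun a b c => ?_
    convert hGauss ((a + b) / 2) c ((a - b) / 2) using 2
    · ext ω
      ring
    · rw [hs, hv]
      congr 1
      ring
  have hpoint : ∀ ω, |(Y₁ ω - u) * (Y₃ ω - u) - (Y₂ ω) ^ 2| =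
      |((Y₁ ω + Y₃ ω) / 2 - u) ^ 2 - (((Y₁ ω - Y₃ ω) / 2) ^ 2 + Y₂ ω ^ 2)| := fun ω => by
    congr 1
    ring
  have hmap := integral_map (μ := ℙ)
    (φ := fun ω => ((Y₁ ω + Y₃ ω) / 2, (Y₁ ω - Y₃ ω) / 2, Y₂ ω))
    (f := fun q : ℝ × ℝ × ℝ => |(q.1 - u) ^ 2 - (q.2.1 ^ 2 + q.2.2 ^ 2)|)
    (by fun_prop) (by fun_prop)
  simp_rw [hpoint]
  rw [← hmap, hlaw, integral_abs_sq_sub_sq_add_sq s hv0, hs, hv]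
  have hpow : (8 * r) ^ ((3 : ℝ) / 2) = 8 * r * (√2 * √(4 * r)) := by
    rw [← sqrt_mul (by norm_num), show (3 : ℝ) / 2 = 1 + 1 / 2 by norm_num,
      rpow_add (by positivity), rpow_one, ← sqrt_eq_rpow]
    ring_nf
  have hden : √(24 * r - 2) = √2 * √(8 * r - 1 + 4 * r) := by
    rw [← sqrt_mul (by norm_num)]
    ring_nf
  have hexp : 2 * (8 * r - 1 + 4 * r) = 24 * r - 2 := by ring
  have hpos : √(8 * r - 1 + 4 * r) ≠ 0 := (sqrt_pos.2 (by linarith)).ne'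
  rw [hpow, hden, hexp]
  field_simp
  ring
end

section
/- Let X and Y be independent standard normal random variables and let θ ∈ (0, π). Then E[ max(X, 0) · 1_{cos θ · X + sin θ · Y ≤ 0} ] = (1 − cos θ)/(2√(2π)). -/
open MeasureTheory ProbabilityTheory Real

/-- Integration against a pair of independent standard normal variables, in polar coordinates. -/
theorem integral_gaussianReal_prod_eq_integral_polar (f : ℝ × ℝ → ℝ) :
    ∫ p, f p ∂((gaussianReal 0 1).prod (gaussianReal 0 1)) =
      ∫ p in Set.Ioi (0 : ℝ) ×ˢ Set.Ioo (-π) π,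
        (p.1 * ((2 * π)⁻¹ * exp (-p.1 ^ 2 / 2))) * f (p.1 * cos p.2, p.1 * sin p.2) := by
  rw [gaussianReal_of_var_ne_zero 0 one_ne_zero,
    prod_withDensity (measurable_gaussianPDF 0 1) (measurable_gaussianPDF 0 1),
    integral_withDensity_eq_integral_toReal_smul
      (f := fun z : ℝ × ℝ ↦ gaussianPDF 0 1 z.1 * gaussianPDF 0 1 z.2)
      (((measurable_gaussianPDF 0 1).comp measurable_fst).mul
        ((measurable_gaussianPDF 0 1).comp measurable_snd))
      (ae_of_all _ fun _ ↦ ENNReal.mul_lt_top gaussianPDF_lt_top gaussianPDF_lt_top),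
    ← Measure.volume_eq_prod, ← integral_comp_polarCoord_symm]
  refine integral_congr_ae (ae_of_all _ fun p ↦ ?_)
  have hexp : exp (-(p.1 * cos p.2) ^ 2 / 2) * exp (-(p.1 * sin p.2) ^ 2 / 2) =
      exp (-p.1 ^ 2 / 2) := by
    rw [← exp_add]
    congr 1
    linear_combination (-p.1 ^ 2 / 2) * sin_sq_add_cos_sq p.2
  have hsqrt : (√(2 * π))⁻¹ * (√(2 * π))⁻¹ = (2 * π)⁻¹ := by
    rw [← mul_inv, mul_self_sqrt (by positivity)]
  simp only [polarCoord_symm_apply, ENNReal.toReal_mul, toReal_gaussianPDF, smul_eq_mul,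
    gaussianPDFReal, NNReal.coe_one, mul_one, sub_zero]
  rw [← hexp, ← hsqrt]
  ring

/-- The second moment of the half-line under the unnormalized Gaussian weight. -/
theorem integral_Ioi_sq_mul_exp_neg_sq_div_two :
    ∫ r in Set.Ioi (0 : ℝ), r ^ 2 * exp (-r ^ 2 / 2) = √(2 * π) / 2 := by
  have h := integral_rpow_mul_exp_neg_mul_rpow (p := 2) (q := 2) (b := 1 / 2)
    (by norm_num) (by norm_num) (by norm_num)
  have hGamma : Gamma ((2 + 1) / 2) = √π / 2 := by
    rw [show ((2 : ℝ) + 1) / 2 = 1 / 2 + 1 by norm_num, Gamma_add_one (by norm_num),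
      Gamma_one_half_eq]
    ring
  have hpow : (1 / 2 : ℝ) ^ (-((2 : ℝ) + 1) / 2) = 2 * √2 := by
    rw [one_div, inv_rpow (by norm_num), ← rpow_neg (by norm_num),
      show -(-((2 : ℝ) + 1) / 2) = 1 + 1 / 2 by norm_num, rpow_add (by norm_num), rpow_one,
      sqrt_eq_rpow]
  rw [hGamma, hpow] at h
  rw [sqrt_mul (by norm_num)]
  calc _ = ∫ r in Set.Ioi (0 : ℝ), r ^ (2 : ℝ) * exp (-(1 / 2) * r ^ (2 : ℝ)) := by
        simp only [rpow_two]
        congr! 4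
        ring
    _ = _ := by rw [h]; ring

/-- The angular factor: the cosine integrates to `1 - cos θ` over the directions in which it is
positive and which make an angle at least `π / 2` with direction `θ`. -/
theorem integral_max_cos_mul_ite {θ : ℝ} (hθ : θ ∈ Set.Ioo 0 π) :
    ∫ t in Set.Ioo (-π) π,
      max (cos t) 0 * (if cos θ * cos t + sin θ * sin t ≤ 0 then (1 : ℝ) else 0) =
      1 - cos θ := by
  obtain ⟨h0, h1⟩ := hθ
  have key : Set.EqOn
      (fun t ↦ max (cos t) 0 * (if cos θ * cos t + sin θ * sin t ≤ 0 then (1 : ℝ) else 0))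
      ((Set.Ioc (-(π / 2)) (θ - π / 2)).indicator cos) (Set.Ioo (-π) π) := by
    rintro t ⟨ht0, ht1⟩
    have hcos : cos θ * cos t + sin θ * sin t = cos (θ - t) := (cos_sub θ t).symm
    simp only [hcos]
    by_cases ht : t ∈ Set.Ioc (-(π / 2)) (θ - π / 2)
    · rw [Set.indicator_of_mem ht]
      obtain ⟨ha, hb⟩ := ht
      rw [max_eq_left (cos_nonneg_of_mem_Icc ⟨ha.le, by linarith⟩),
        if_pos (cos_nonpos_of_pi_div_two_le_of_le (by linarith) (by linarith)), mul_one]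
    · rw [Set.indicator_of_notMem ht]
      rcases le_or_gt t (-(π / 2)) with ha | ha
      · rw [max_eq_right, zero_mul]
        rw [← cos_neg]
        exact cos_nonpos_of_pi_div_two_le_of_le (by linarith) (by linarith)
      · have hb : θ - π / 2 < t := not_le.mp fun hb ↦ ht ⟨ha, hb⟩
        rcases le_or_gt (π / 2) t with hc | hc
        · rw [max_eq_right (cos_nonpos_of_pi_div_two_le_of_le hc (by linarith)), zero_mul]
        · rw [if_neg (cos_pos_of_mem_Ioo ⟨by linarith, by linarith⟩).not_ge, mul_zero]
  have hsub : Set.Ioc (-(π / 2)) (θ - π / 2) ⊆ Set.Ioo (-π) π :=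
    fun t ht ↦ ⟨by linarith [ht.1], by linarith [ht.2]⟩
  rw [setIntegral_congr_fun measurableSet_Ioo key, setIntegral_indicator measurableSet_Ioc,
    Set.inter_eq_right.mpr hsub,
    ← intervalIntegral.integral_of_le (by linarith), integral_cos, sin_sub_pi_div_two, sin_neg,
    sin_pi_div_two]
  ring

open Classical in
/-- Boundary-edge computation in the proof of Theorem 2.1: for `X, Y` independent
standard normals and `θ ∈ (0, π)`,
`E[max(X,0) · 1_{cos θ · X + sin θ · Y ≤ 0}] = (1 - cos θ) / (2 √(2π))`. -/
theorem expectation_pos_part_indicator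
    {Ω : Type*} [MeasureSpace Ω] [IsProbabilityMeasure (ℙ : Measure Ω)]
    (X Y : Ω → ℝ) (hX : Measurable X) (hY : Measurable Y)
    (hXlaw : Measure.map X ℙ = gaussianReal 0 1)
    (hYlaw : Measure.map Y ℙ = gaussianReal 0 1)
    (hindep : IndepFun X Y ℙ)
    (θ : ℝ) (hθ : θ ∈ Set.Ioo 0 Real.pi) :
    (∫ ω, max (X ω) 0 *
        (if Real.cos θ * X ω + Real.sin θ * Y ω ≤ 0 then (1 : ℝ) else 0)) =
      (1 - Real.cos θ) / (2 * Real.sqrt (2 * Real.pi)) := by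
  have hmap : Measure.map (fun ω ↦ (X ω, Y ω)) ℙ =
      (gaussianReal 0 1).prod (gaussianReal 0 1) := by
    rw [(indepFun_iff_map_prod_eq_prod_map_map hX.aemeasurable hY.aemeasurable).mp hindep,
      hXlaw, hYlaw]
  let f : ℝ × ℝ → ℝ := fun p ↦
    max p.1 0 * (if cos θ * p.1 + sin θ * p.2 ≤ 0 then (1 : ℝ) else 0)
  have hf : Measurable f :=
    (measurable_fst.max measurable_const).mul
      (Measurable.ite (measurableSet_le (by fun_prop) measurable_const)
        measurable_const measurable_const)
  have hpolar : Set.EqOn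
      (fun p : ℝ × ℝ ↦
        (p.1 * ((2 * π)⁻¹ * exp (-p.1 ^ 2 / 2))) * f (p.1 * cos p.2, p.1 * sin p.2))
      (fun p ↦ ((2 * π)⁻¹ * (p.1 ^ 2 * exp (-p.1 ^ 2 / 2))) * (max (cos p.2) 0 *
        (if cos θ * cos p.2 + sin θ * sin p.2 ≤ 0 then (1 : ℝ) else 0)))
      (Set.Ioi (0 : ℝ) ×ˢ Set.Ioo (-π) π) := by
    rintro ⟨r, t⟩ ⟨hr, -⟩
    have hr : 0 < r := hr
    have hmax : max (r * cos t) 0 = r * max (cos t) 0 := by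
      rw [mul_max_of_nonneg _ _ hr.le, mul_zero]
    have hiff : cos θ * (r * cos t) + sin θ * (r * sin t) ≤ 0 ↔
        cos θ * cos t + sin θ * sin t ≤ 0 := by
      rw [show cos θ * (r * cos t) + sin θ * (r * sin t) =
        r * (cos θ * cos t + sin θ * sin t) by ring, mul_nonpos_iff_pos_imp_nonpos]
      exact ⟨fun h ↦ h.1 hr, fun h ↦ ⟨fun _ ↦ h, fun _ ↦ hr.le⟩⟩
    simp only [f, hmax, hiff]
    ring
  calc _ = ∫ p, f p ∂(Measure.map (fun ω ↦ (X ω, Y ω)) ℙ) :=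
        (integral_map (hX.prodMk hY).aemeasurable hf.aestronglyMeasurable).symm
    _ = (2 * π)⁻¹ * (√(2 * π) / 2) * (1 - cos θ) := by
        rw [hmap, integral_gaussianReal_prod_eq_integral_polar,
          setIntegral_congr_fun (measurableSet_Ioi.prod measurableSet_Ioo) hpolar,
          Measure.volume_eq_prod,
          setIntegral_prod_mul (fun r : ℝ ↦ (2 * π)⁻¹ * (r ^ 2 * exp (-r ^ 2 / 2)))
            (fun t : ℝ ↦ max (cos t) 0 *
              (if cos θ * cos t + sin θ * sin t ≤ 0 then (1 : ℝ) else 0)),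
          integral_const_mul, integral_Ioi_sq_mul_exp_neg_sq_div_two,
          integral_max_cos_mul_ite hθ]
    _ = _ := by
        have hsq : √(2 * π) ^ 2 = 2 * π := sq_sqrt (by positivity)
        have hpos : 0 < √(2 * π) := by positivity
        generalize √(2 * π) = s at hsq hpos ⊢
        rw [← hsq]
        field_simp
end

section
/- For every m ∈ ℝ, ∫_{−∞}^0 φ(x)·Φ(m·x) dx = 1/4 − arctan(m)/(2π). -/
open MeasureTheory Real

/-- The standard normal density `φ`. -/
noncomputable def stdGaussianPDF (x : ℝ) : ℝ :=
  (Real.sqrt (2 * Real.pi))⁻¹ * Real.exp (-x ^ 2 / 2)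

/-- The standard normal distribution function `Φ`. -/
noncomputable def stdGaussianCDF (x : ℝ) : ℝ :=
  ∫ t in Set.Iic x, stdGaussianPDF t

theorem continuous_stdGaussianPDF : Continuous stdGaussianPDF := by
  unfold stdGaussianPDF
  fun_prop

theorem stdGaussianPDF_nonneg (x : ℝ) : 0 ≤ stdGaussianPDF x := by
  unfold stdGaussianPDF
  positivity

theorem stdGaussianPDF_le (x : ℝ) : stdGaussianPDF x ≤ (√(2 * π))⁻¹ :=
  mul_le_of_le_one_right (by positivity) (exp_le_one_iff.2 (by nlinarith [sq_nonneg x]))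

theorem stdGaussianPDF_neg (x : ℝ) : stdGaussianPDF (-x) = stdGaussianPDF x := by
  simp [stdGaussianPDF]

theorem stdGaussianPDF_eq (x : ℝ) :
    stdGaussianPDF x = (√(2 * π))⁻¹ * exp (-(1 / 2) * x ^ 2) := by
  rw [stdGaussianPDF]
  congr 2
  ring

theorem integrable_stdGaussianPDF : Integrable stdGaussianPDF :=
  ((integrable_exp_neg_mul_sq one_half_pos).const_mul (√(2 * π))⁻¹).congr
    (.of_forall fun x => (stdGaussianPDF_eq x).symm)

theorem integrable_mul_stdGaussianPDF : Integrable fun x => x * stdGaussianPDF x :=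
  ((integrable_mul_exp_neg_mul_sq one_half_pos).const_mul (√(2 * π))⁻¹).congr
    (.of_forall fun x => by simp only [stdGaussianPDF_eq]; ring)

theorem stdGaussianPDF_mul_stdGaussianPDF (x y : ℝ) :
    stdGaussianPDF x * stdGaussianPDF y = (2 * π)⁻¹ * exp (-(x ^ 2 + y ^ 2) / 2) := by
  have h : (√(2 * π))⁻¹ * (√(2 * π))⁻¹ = (2 * π)⁻¹ := by
    rw [← mul_inv, mul_self_sqrt (by positivity)]
  rw [stdGaussianPDF, stdGaussianPDF, mul_mul_mul_comm, h, ← exp_add]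
  congr 2
  ring

theorem stdGaussianCDF_zero : stdGaussianCDF 0 = 1 / 2 := by
  rw [stdGaussianCDF, ← neg_zero, ← integral_comp_neg_Ioi]
  simp_rw [stdGaussianPDF_neg, stdGaussianPDF_eq]
  rw [integral_const_mul, integral_gaussian_Ioi, show π / (1 / 2) = 2 * π by ring]
  field_simp

theorem hasDerivAt_stdGaussianCDF (x : ℝ) :
    HasDerivAt stdGaussianCDF (stdGaussianPDF x) x := by
  have h : stdGaussianCDF = fun y => stdGaussianCDF 0 + ∫ t in (0 : ℝ)..y, stdGaussianPDF t := by
    ext y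
    rw [← intervalIntegral.integral_Iic_sub_Iic integrable_stdGaussianPDF.integrableOn
      integrable_stdGaussianPDF.integrableOn, stdGaussianCDF, stdGaussianCDF]
    ring
  rw [h]
  exact (continuous_stdGaussianPDF.integral_hasStrictDerivAt 0 x).hasDerivAt.const_add _

theorem continuous_stdGaussianCDF : Continuous stdGaussianCDF :=
  continuous_iff_continuousAt.2 fun x => (hasDerivAt_stdGaussianCDF x).continuousAt

theorem norm_stdGaussianCDF_le (x : ℝ) : ‖stdGaussianCDF x‖ ≤ ∫ t, stdGaussianPDF t := by
  rw [stdGaussianCDF, norm_of_nonneg (integral_nonneg stdGaussianPDF_nonneg)]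
  exact setIntegral_le_integral integrable_stdGaussianPDF (.of_forall stdGaussianPDF_nonneg)

theorem integral_Iic_mul_exp_neg_mul_sq {b : ℝ} (hb : 0 < b) :
    ∫ x in Set.Iic (0 : ℝ), x * exp (-b * x ^ 2) = -(2 * b)⁻¹ := by
  have hderiv (x : ℝ) :
      HasDerivAt (fun y => -(2 * b)⁻¹ * exp (-b * y ^ 2)) (x * exp (-b * x ^ 2)) x := by
    refine (((hasDerivAt_pow 2 x).const_mul (-b)).exp.const_mul (-(2 * b)⁻¹)).congr_deriv ?_
    push_cast
    field_simp
  have hsq : Filter.Tendsto (fun x : ℝ => x ^ 2) Filter.atBot Filter.atTop := by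
    simpa [Function.comp_def] using
      (Filter.tendsto_pow_atTop two_ne_zero).comp (Filter.tendsto_abs_atBot_atTop (G := ℝ))
  have hlim : Filter.Tendsto (fun x => -(2 * b)⁻¹ * exp (-b * x ^ 2)) Filter.atBot (nhds 0) := by
    simpa using ((tendsto_exp_atBot.comp
      (hsq.const_mul_atTop_of_neg (neg_lt_zero.2 hb))).const_mul (-(2 * b)⁻¹))
  rw [integral_Iic_of_hasDerivAt_of_tendsto' (fun x _ => hderiv x)
    (integrable_mul_exp_neg_mul_sq hb).integrableOn hlim]
  simp

theorem hasDerivAt_integral_pdf_mul_cdf_Iic (m : ℝ) :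
    HasDerivAt (fun m => ∫ x in Set.Iic (0 : ℝ), stdGaussianPDF x * stdGaussianCDF (m * x))
      (-(1 / (1 + m ^ 2)) / (2 * π)) m := by
  have hcont (m : ℝ) : Continuous fun x => stdGaussianPDF x * stdGaussianCDF (m * x) :=
    continuous_stdGaussianPDF.mul (continuous_stdGaussianCDF.comp (continuous_const_mul m))
  have hint : Integrable (fun x => stdGaussianPDF x * stdGaussianCDF (m * x)) :=
    integrable_stdGaussianPDF.mul_bdd
      (continuous_stdGaussianCDF.comp (continuous_const_mul m)).aestronglyMeasurable
      (.of_forall fun x => norm_stdGaussianCDF_le (m * x))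
  have hderiv := (hasDerivAt_integral_of_dominated_loc_of_deriv_le
    (μ := volume.restrict (Set.Iic (0 : ℝ)))
    (F := fun m x => stdGaussianPDF x * stdGaussianCDF (m * x))
    (F' := fun m x => stdGaussianPDF x * (stdGaussianPDF (m * x) * x))
    (bound := fun x => ‖x * stdGaussianPDF x‖ * (√(2 * π))⁻¹)
    (x₀ := m) Filter.univ_mem (.of_forall fun m => (hcont m).aestronglyMeasurable)
    hint.integrableOn
    (continuous_stdGaussianPDF.mul ((continuous_stdGaussianPDF.comp
      (continuous_const_mul m)).mul continuous_id)).aestronglyMeasurable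
    (.of_forall fun x m _ => ?_)
    (integrable_mul_stdGaussianPDF.norm.mul_const _).integrableOn
    (.of_forall fun x m _ => ?_)).2
  · refine hderiv.congr_deriv ?_
    have hb : 0 < (1 + m ^ 2) / 2 := by positivity
    have hprod (x : ℝ) : stdGaussianPDF x * (stdGaussianPDF (m * x) * x) =
        (2 * π)⁻¹ * (x * exp (-((1 + m ^ 2) / 2) * x ^ 2)) := by
      rw [← mul_assoc, stdGaussianPDF_mul_stdGaussianPDF,
        show -(x ^ 2 + (m * x) ^ 2) / 2 = -((1 + m ^ 2) / 2) * x ^ 2 by ring]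
      ring
    rw [integral_congr_ae (.of_forall hprod), integral_const_mul, integral_Iic_mul_exp_neg_mul_sq hb]
    field_simp
  · calc ‖stdGaussianPDF x * (stdGaussianPDF (m * x) * x)‖
        = ‖x * stdGaussianPDF x‖ * stdGaussianPDF (m * x) := by
          simp only [norm_mul, norm_of_nonneg (stdGaussianPDF_nonneg _)]
          ring
      _ ≤ _ := by gcongr; exact stdGaussianPDF_le _
  · exact ((hasDerivAt_stdGaussianCDF (m * x)).comp m (hasDerivAt_mul_const x)).const_mul _

/-- `∫_{-∞}^0 φ(x) Φ(mx) dx = 1/4 - arctan(m)/(2π)`. -/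
theorem integral_pdf_mul_cdf_Iic (m : ℝ) :
    (∫ x in Set.Iic (0 : ℝ), stdGaussianPDF x * stdGaussianCDF (m * x)) =
      1 / 4 - Real.arctan m / (2 * Real.pi) := by
  have hderiv (m : ℝ) := (hasDerivAt_integral_pdf_mul_cdf_Iic m).add
    ((hasDerivAt_arctan m).div_const (2 * π))
  have hconst := is_const_of_deriv_eq_zero (fun m => (hderiv m).differentiableAt)
    (fun m => by rw [(hderiv m).deriv]; ring) m 0
  have hzero : ∫ x in Set.Iic (0 : ℝ), stdGaussianPDF x * stdGaussianCDF (0 * x) = 1 / 4 := by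
    simp_rw [zero_mul]
    rw [integral_mul_const, ← stdGaussianCDF, stdGaussianCDF_zero]
    norm_num
  simp only [Pi.add_apply, hzero, arctan_zero, zero_div, add_zero] at hconst
  exact eq_sub_of_add_eq hconst
end

section
/- Let θ₁, θ₂, θ₃ ∈ (0, π) and let (U, V, W) be a centered Gaussian random vector in ℝ³ with Var(U) = Var(V) = Var(W) = 1, Cov(U,V) = Cov(U,W) = 0 and Cov(V,W) = cos θ₃. Then E[ max(U,0) · 1_{cos θ₁·U + sin θ₁·V ≤ 0} · 1_{cos θ₂·U + sin θ₂·W ≤ 0} ] = (π − θ₃)/(2π)^{3/2} − (cos θ₂/√(2π))·(1/4 + (1/(2π))·arctan((−sin θ₂·cot θ₁ + cos θ₃·cos θ₂)/sin θ₃)) − (cos θ₁/√(2π))·(1/4 + (1/(2π))·arctan((−sin θ₁·cot θ₂ + cos θ₃·cos θ₁)/sin θ₃)). -/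
open MeasureTheory ProbabilityTheory Real

open Set Filter Topology

local notation "φ" => gaussianPDFReal 0 1
local notation "Φ" => cdf (gaussianReal 0 1)

/-- A random vector in `ℝ³` all of whose linear combinations are centered Gaussian with the
variance of independent standard Gaussians has the standard Gaussian law. -/
theorem map_prodMk_eq_prod_gaussianReal {Ω : Type*} [MeasurableSpace Ω] {P : Measure Ω}
    [IsProbabilityMeasure P] {X Y Z : Ω → ℝ} (hX : Measurable X) (hY : Measurable Y)
    (hZ : Measurable Z)
    (h : ∀ r s t : ℝ, P.map (fun ω => r * X ω + s * Y ω + t * Z ω) =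
      gaussianReal 0 (r ^ 2 + s ^ 2 + t ^ 2).toNNReal) :
    P.map (fun ω => (X ω, Y ω, Z ω)) =
      (gaussianReal 0 1).prod ((gaussianReal 0 1).prod (gaussianReal 0 1)) := by
  have hm : Measurable (fun ω => (X ω, Y ω, Z ω)) := hX.prodMk (hY.prodMk hZ)
  have : IsProbabilityMeasure (P.map (fun ω => (X ω, Y ω, Z ω))) :=
    Measure.isProbabilityMeasure_map hm.aemeasurable
  have hdual (L : StrongDual ℝ ℝ) :
      charFunDual (gaussianReal 0 1) L = Complex.exp (-(L 1 : ℂ) ^ 2 / 2) := by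
    have hL : ⇑L = fun x => L 1 * x := by
      ext x
      simpa [mul_comm] using L.map_smul x 1
    rw [charFunDual_eq_charFun_map_one, hL, gaussianReal_map_const_mul, charFun_gaussianReal]
    simp
    ring_nf
  refine Measure.ext_of_charFunDual (funext fun L => ?_)
  rw [charFunDual_prod, charFunDual_prod, hdual, hdual, hdual, charFunDual_eq_charFun_map_one,
    Measure.map_map L.measurable hm]
  have hL : (⇑L ∘ fun ω => (X ω, Y ω, Z ω)) =
      fun ω => L (1, 0, 0) * X ω + L (0, 1, 0) * Y ω + L (0, 0, 1) * Z ω := by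
    ext ω
    have : (X ω, Y ω, Z ω) = X ω • ((1 : ℝ), (0 : ℝ), (0 : ℝ)) +
      Y ω • ((0 : ℝ), (1 : ℝ), (0 : ℝ)) + Z ω • ((0 : ℝ), (0 : ℝ), (1 : ℝ)) := by simp
    simp only [Function.comp_apply]
    rw [this, map_add, map_add, map_smul, map_smul, map_smul]
    simp only [smul_eq_mul]
    ring
  rw [hL, h, charFun_gaussianReal, ← Complex.exp_add, ← Complex.exp_add,
    Real.coe_toNNReal _ (by positivity)]
  congr 1
  simp
  rw [show ((1 : ℝ), (0 : ℝ × ℝ)) = (1, 0, 0) from rfl]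
  ring

theorem gaussianPDFReal_zero_one_apply (x : ℝ) :
    φ x = (√(2 * π))⁻¹ * exp (-x ^ 2 / 2) := by
  simp [gaussianPDFReal]

theorem hasDerivAt_gaussianPDFReal_zero_one (x : ℝ) : HasDerivAt φ (-x * φ x) x := by
  have h : (φ : ℝ → ℝ) = fun x => (√(2 * π))⁻¹ * exp (-x ^ 2 / 2) :=
    funext gaussianPDFReal_zero_one_apply
  rw [h]
  convert! ((((hasDerivAt_id x).pow 2).neg.div_const 2).exp.const_mul (√(2 * π))⁻¹) using 1
  simp
  ring

theorem continuous_gaussianPDFReal_zero_one : Continuous φ :=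
  continuous_iff_continuousAt.2 fun x => (hasDerivAt_gaussianPDFReal_zero_one x).continuousAt

theorem gaussianPDFReal_zero_one_neg (x : ℝ) : φ (-x) = φ x := by
  simp [gaussianPDFReal_zero_one_apply]

theorem gaussianPDFReal_zero_one_le_one (x : ℝ) : φ x ≤ 1 := by
  rw [gaussianPDFReal_zero_one_apply]
  have h1 : (√(2 * π))⁻¹ ≤ 1 := inv_le_one_of_one_le₀ (by
    rw [one_le_sqrt]; nlinarith [pi_gt_three])
  have h2 : exp (-x ^ 2 / 2) ≤ 1 := exp_le_one_iff.2 (by nlinarith [sq_nonneg x])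
  exact mul_le_one₀ h1 (exp_pos _).le h2

theorem gaussianPDFReal_zero_one_mul_mul {x y z w : ℝ} (h : x ^ 2 + y ^ 2 = z ^ 2 + w ^ 2) :
    φ x * φ y = φ z * φ w := by
  simp only [gaussianPDFReal_zero_one_apply]
  have : exp (-x ^ 2 / 2) * exp (-y ^ 2 / 2) = exp (-z ^ 2 / 2) * exp (-w ^ 2 / 2) := by
    rw [← exp_add, ← exp_add]
    congr 1
    linarith
  linear_combination (√(2 * π))⁻¹ ^ 2 * this

theorem integrable_mul_gaussianPDFReal_zero_one : Integrable fun x => x * φ x := by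
  have := (integrable_mul_exp_neg_mul_sq (b := 1 / 2) (by norm_num)).const_mul (√(2 * π))⁻¹
  refine this.congr (ae_of_all _ fun x => ?_)
  simp only [gaussianPDFReal_zero_one_apply]
  rw [show -x ^ 2 / 2 = -(1 / 2) * x ^ 2 by ring]
  ring

theorem tendsto_gaussianPDFReal_zero_one_atTop : Tendsto φ atTop (𝓝 0) := by
  have h : (φ : ℝ → ℝ) = fun x => (√(2 * π))⁻¹ * exp (-x ^ 2 / 2) :=
    funext gaussianPDFReal_zero_one_apply
  rw [h, ← mul_zero (√(2 * π))⁻¹]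
  refine Tendsto.const_mul _ (tendsto_exp_atBot.comp ?_)
  have : Tendsto (fun x : ℝ => x ^ 2 / 2) atTop atTop :=
    (tendsto_pow_atTop two_ne_zero).atTop_div_const two_pos
  simpa only [neg_div] using! tendsto_neg_atTop_atBot.comp this

theorem cdf_gaussianReal_zero_one_eq (x : ℝ) : Φ x = ∫ t in Iic x, φ t := by
  rw [cdf_eq_real, measureReal_def, gaussianReal_apply_eq_integral _ one_ne_zero,
    ENNReal.toReal_ofReal]
  exact integral_nonneg fun t => gaussianPDFReal_nonneg 0 1 t

theorem hasDerivAt_cdf_gaussianReal_zero_one (x : ℝ) : HasDerivAt Φ (φ x) x := by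
  have h : (Φ : ℝ → ℝ) = fun x => (∫ t in Iic 0, φ t) + ∫ t in (0 : ℝ)..x, φ t := by
    ext x
    rw [cdf_gaussianReal_zero_one_eq, ← intervalIntegral.integral_Iic_sub_Iic
      (integrable_gaussianPDFReal 0 1).integrableOn (integrable_gaussianPDFReal 0 1).integrableOn,
      add_sub_cancel]
  rw [h]
  exact (intervalIntegral.integral_hasDerivAt_right
    (continuous_gaussianPDFReal_zero_one.intervalIntegrable _ _)
    (continuous_gaussianPDFReal_zero_one.stronglyMeasurableAtFilter _ _)
    continuous_gaussianPDFReal_zero_one.continuousAt).const_add _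

theorem continuous_cdf_gaussianReal_zero_one : Continuous Φ :=
  continuous_iff_continuousAt.2 fun x => (hasDerivAt_cdf_gaussianReal_zero_one x).continuousAt

theorem abs_cdf_le_one (μ : Measure ℝ) (x : ℝ) : |cdf μ x| ≤ 1 :=
  abs_le.2 ⟨by linarith [cdf_nonneg μ x], cdf_le_one μ x⟩

theorem integrable_mul_comp_shear {f g : ℝ → ℝ} (hf : Integrable f) (hg : Integrable g) (a : ℝ) :
    Integrable fun p : ℝ × ℝ => f p.1 * g (p.2 + a * p.1) := by
  have h : MeasurePreserving (fun p : ℝ × ℝ => (p.1, p.2 + a * p.1)) := by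
    exact (MeasurePreserving.id volume).skew_product (g := fun u y => y + a * u) (by fun_prop)
      (ae_of_all _ fun u => map_add_right_eq_self volume (a * u))
  exact h.integrable_comp_of_integrable (hf.mul_prod hg)

theorem cdf_gaussianReal_zero_one_zero : Φ 0 = 1 / 2 := by
  have h1 : ∫ t in Ioi (0:ℝ), φ t = ∫ t in Iic (0:ℝ), φ t := by
    rw [← neg_zero, ← integral_comp_neg_Ioi]
    simp [gaussianPDFReal_zero_one_neg]
  have h2 := intervalIntegral.integral_Iic_add_Ioi (b := (0:ℝ))
    (integrable_gaussianPDFReal 0 1).integrableOn (integrable_gaussianPDFReal 0 1).integrableOn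
  rw [integral_gaussianPDFReal_eq_one 0 one_ne_zero, h1] at h2
  rw [cdf_gaussianReal_zero_one_eq]
  linarith

theorem integral_Ioi_gaussianPDFReal_zero_one (x : ℝ) : ∫ t in Ioi x, φ t = Φ (-x) := by
  rw [cdf_gaussianReal_zero_one_eq, ← integral_comp_neg_Ioi]
  simp [gaussianPDFReal_zero_one_neg]

theorem integral_Ioi_gaussianPDFReal_zero_one_comp {r : ℝ} (hr : 0 < r) (x : ℝ) :
    ∫ y in Ioi 0, φ (r * y + x) = Φ (-x) / r := by
  have h := integral_comp_mul_left_Ioi (fun y => φ (y + x)) 0 hr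
  have h' := (measurePreserving_add_right volume x).setIntegral_preimage_emb
    (measurableEmbedding_addRight x) φ (Ioi x)
  rw [preimage_add_const_Ioi, sub_self] at h'
  simp only [mul_zero, smul_eq_mul] at h
  rw [h, h', integral_Ioi_gaussianPDFReal_zero_one]
  ring

theorem integral_Ioi_mul_gaussianPDFReal_zero_one_mul (c : ℝ) :
    ∫ u in Ioi 0, u * (φ u * φ (c * u)) = 1 / (2 * π) * (1 / (1 + c ^ 2)) := by
  have hc : 0 < 1 + c ^ 2 := by positivity
  set r := √(1 + c ^ 2)
  have hr : 0 < r := sqrt_pos.2 hc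
  have hr2 : r ^ 2 = 1 + c ^ 2 := sq_sqrt hc.le
  have h0 : φ 0 ^ 2 = 1 / (2 * π) := by
    rw [gaussianPDFReal_zero_one_apply, mul_pow, inv_pow, sq_sqrt (by positivity)]
    simp
  have h1 : ∀ u, u * (φ u * φ (c * u)) = φ 0 * r⁻¹ * ((r * u) * φ (r * u)) := fun u => by
    rw [gaussianPDFReal_zero_one_mul_mul (x := u) (y := c * u) (z := 0) (w := r * u)
      (by rw [mul_pow, mul_pow, hr2]; ring)]
    field_simp
  have h2 : ∫ u in Ioi 0, u * φ u = φ 0 := by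
    have := integral_Ioi_of_hasDerivAt_of_tendsto' (a := 0) (m := -0) (f := fun x => -φ x)
      (f' := fun x => x * φ x)
      (fun x _ => by simpa using (hasDerivAt_gaussianPDFReal_zero_one x).fun_neg)
      integrable_mul_gaussianPDFReal_zero_one.integrableOn
      tendsto_gaussianPDFReal_zero_one_atTop.neg
    simpa using this
  simp_rw [h1]
  rw [integral_const_mul, integral_comp_mul_left_Ioi (fun u => u * φ u) 0 hr, mul_zero, h2,
    ← hr2, ← h0, smul_eq_mul]
  field_simp

theorem integral_Ioi_gaussianPDFReal_mul_cdf (c : ℝ) :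
    ∫ u in Ioi 0, φ u * Φ (c * u) = 1 / 4 + 1 / (2 * π) * arctan c := by
  have hderiv (c : ℝ) : HasDerivAt (fun c => ∫ u in Ioi 0, φ u * Φ (c * u))
      (1 / (2 * π) * (1 / (1 + c ^ 2))) c := by
    rw [← integral_Ioi_mul_gaussianPDFReal_zero_one_mul]
    have hφ := continuous_gaussianPDFReal_zero_one
    have hΦ := continuous_cdf_gaussianReal_zero_one
    refine (hasDerivAt_integral_of_dominated_loc_of_deriv_le (s := univ)
      (F := fun c u => φ u * Φ (c * u)) (F' := fun c u => u * (φ u * φ (c * u)))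
      (bound := fun u => ‖u * φ u‖) univ_mem ?_ ?_ ?_ ?_ ?_ ?_).2
    · exact Eventually.of_forall fun x => (by fun_prop : Continuous _).aestronglyMeasurable
    · refine ((integrable_gaussianPDFReal 0 1).mul_bdd (c := 1) ?_ ?_).integrableOn
      · exact (by fun_prop : Continuous _).aestronglyMeasurable
      · exact ae_of_all _ fun u => abs_cdf_le_one _ _
    · exact (by fun_prop : Continuous _).aestronglyMeasurable
    · refine ae_of_all _ fun u x _ => ?_
      rw [← mul_assoc, norm_mul]
      refine mul_le_of_le_one_right (norm_nonneg _) ?_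
      rw [norm_of_nonneg (gaussianPDFReal_nonneg 0 1 _)]
      exact gaussianPDFReal_zero_one_le_one _
    · exact integrable_mul_gaussianPDFReal_zero_one.norm.integrableOn
    · refine ae_of_all _ fun u x _ => ?_
      convert! ((hasDerivAt_cdf_gaussianReal_zero_one (x * u)).comp x
        ((hasDerivAt_id x).mul_const u)).const_mul (φ u) using 1
      ring
  have hconst := is_const_of_deriv_eq_zero
    (f := fun c => (∫ u in Ioi 0, φ u * Φ (c * u)) - 1 / (2 * π) * arctan c)
    (fun c => ((hderiv c).fun_sub ((hasDerivAt_arctan c).const_mul _)).differentiableAt)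
    (fun c => by rw [((hderiv c).fun_sub ((hasDerivAt_arctan c).const_mul _)).deriv, sub_self]) c 0
  simp only [zero_mul, cdf_gaussianReal_zero_one_zero, integral_mul_const,
    integral_Ioi_gaussianPDFReal_zero_one, arctan_zero, neg_zero] at hconst
  linarith

theorem integral_Ioi_gaussianPDFReal_mul_gaussianPDFReal_mul_cdf {a r : ℝ} (hr : 0 < r)
    (har : r ^ 2 = 1 + a ^ 2) (c : ℝ) :
    ∫ u in Ioi 0, φ u * φ (a * u) * Φ (c * u) =
      φ 0 / r * (1 / 4 + 1 / (2 * π) * arctan (c / r)) := by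
  have h1 : ∀ u, φ u * φ (a * u) * Φ (c * u) = φ 0 * (φ (r * u) * Φ (c / r * (r * u))) :=
    fun u => by
    rw [gaussianPDFReal_zero_one_mul_mul (x := u) (y := a * u) (z := 0) (w := r * u)
      (by rw [mul_pow, mul_pow, har]; ring), ← mul_assoc (c / r), div_mul_cancel₀ _ hr.ne']
    ring
  simp_rw [h1]
  rw [integral_const_mul, integral_comp_mul_left_Ioi (fun u => φ u * Φ (c / r * u)) 0 hr, mul_zero,
    integral_Ioi_gaussianPDFReal_mul_cdf, smul_eq_mul]
  ring

theorem tendsto_gaussianPDFReal_mul_atTop_zero {f : ℝ → ℝ} {M : ℝ} (hf : ∀ x, |f x| ≤ M) :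
    Tendsto (fun x => φ x * f x) atTop (𝓝 0) := by
  refine squeeze_zero_norm (a := fun x => φ x * M) (fun x => ?_)
    (by simpa using tendsto_gaussianPDFReal_zero_one_atTop.mul_const M)
  rw [norm_mul, norm_of_nonneg (gaussianPDFReal_nonneg 0 1 x)]
  exact mul_le_mul_of_nonneg_left (hf x) (gaussianPDFReal_nonneg 0 1 x)

theorem abs_gaussianPDFReal_zero_one_le_one (x : ℝ) : |φ x| ≤ 1 := by
  rw [abs_of_nonneg (gaussianPDFReal_nonneg 0 1 x)]
  exact gaussianPDFReal_zero_one_le_one x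

/-- Integration by parts over a quadrant, along the direction `(1, -a)`. -/
theorem integral_Ioi_integral_Ioi_mul_gaussianPDFReal (a c k : ℝ) :
    ∫ u in Ioi 0, ∫ y in Ioi 0, u * φ u * φ (y + a * u) * Φ (c * u + k * y) =
      φ 0 * (∫ y in Ioi 0, φ y * Φ (k * y)) - a * (∫ u in Ioi 0, φ u * φ (a * u) * Φ (c * u)) +
      (c - a * k) * ∫ u in Ioi 0, ∫ y in Ioi 0, φ u * φ (y + a * u) * φ (c * u + k * y) := by
  have hφ := continuous_gaussianPDFReal_zero_one
  have hΦ := continuous_cdf_gaussianReal_zero_one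
  have hφ' := hasDerivAt_gaussianPDFReal_zero_one
  have hΦ' := hasDerivAt_cdf_gaussianReal_zero_one
  have hφi := integrable_gaussianPDFReal 0 1
  have hxφ := integrable_mul_gaussianPDFReal_zero_one
  let ν : Measure ℝ := volume.restrict (Ioi 0)
  have hres {f : ℝ × ℝ → ℝ} (hf : Integrable f) : Integrable f (ν.prod ν) := by
    rw [Measure.prod_restrict]
    exact hf.integrableOn
  have hbdd {f g : ℝ → ℝ} (hf : Integrable f) (hg : Integrable g) {w : ℝ → ℝ} (hw : Continuous w)
      (hw1 : ∀ x, |w x| ≤ 1) :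
      Integrable (fun p : ℝ × ℝ => f p.1 * g (p.2 + a * p.1) * w (c * p.1 + k * p.2))
        (ν.prod ν) :=
    hres ((integrable_mul_comp_shear hf hg a).mul_bdd (c := 1)
      (by fun_prop : Continuous _).aestronglyMeasurable (ae_of_all _ fun p => hw1 _))
  have hA := hbdd hxφ hφi hΦ (abs_cdf_le_one _)
  have hB := hbdd hφi hφi hφ abs_gaussianPDFReal_zero_one_le_one
  have hC := hbdd hφi hxφ hΦ (abs_cdf_le_one _)
  set A : ℝ × ℝ → ℝ := fun p => p.1 * φ p.1 * φ (p.2 + a * p.1) * Φ (c * p.1 + k * p.2)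
  set B : ℝ × ℝ → ℝ := fun p => φ p.1 * φ (p.2 + a * p.1) * φ (c * p.1 + k * p.2)
  set C : ℝ × ℝ → ℝ := fun p =>
    φ p.1 * ((p.2 + a * p.1) * φ (p.2 + a * p.1)) * Φ (c * p.1 + k * p.2)
  let Py : ℝ × ℝ → ℝ := fun p => k * B p - C p
  let Pu : ℝ × ℝ → ℝ := fun p => c * B p - A p - a * C p
  have hPy : Integrable Py (ν.prod ν) := (hB.const_mul k).sub hC
  have hPu : Integrable Pu (ν.prod ν) := ((hB.const_mul c).sub hA).sub (hC.const_mul a)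
  have hy : ∫ p, Py p ∂(ν.prod ν) = -∫ u in Ioi 0, φ u * φ (a * u) * Φ (c * u) := by
    rw [integral_prod _ hPy, ← integral_neg]
    refine integral_congr_ae ?_
    filter_upwards [hPy.prod_right_ae] with u hu
    have := integral_Ioi_of_hasDerivAt_of_tendsto' (a := 0) (m := 0)
      (f := fun y => φ u * φ (y + a * u) * Φ (c * u + k * y)) (f' := fun y => Py (u, y))
      (fun y _ => ?_) hu ?_
    · simpa using this
    · convert! (((hφ' (y + a * u)).comp y ((hasDerivAt_id y).add_const (a * u))).const_mul
        (φ u)).mul ((hΦ' (c * u + k * y)).comp y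
          (((hasDerivAt_id y).const_mul k).const_add (c * u))) using 1
      simp only [Py, B, C, Function.comp_apply, id]
      ring
    · have h := (tendsto_gaussianPDFReal_mul_atTop_zero (M := 1)
        (f := fun y => φ u * Φ (c * u + k * (y - a * u))) fun y => ?_).comp
        (tendsto_atTop_add_const_right atTop (a * u) tendsto_id)
      · refine h.congr fun y => ?_
        simp only [Function.comp_apply, id, add_sub_cancel_right]
        ring
      · rw [abs_mul]
        exact mul_le_one₀ (abs_gaussianPDFReal_zero_one_le_one _) (abs_nonneg _)
          (abs_cdf_le_one _ _)
  have hu : ∫ p, Pu p ∂(ν.prod ν) = -(φ 0 * ∫ y in Ioi 0, φ y * Φ (k * y)) := by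
    rw [integral_prod_symm _ hPu, ← integral_const_mul, ← integral_neg]
    refine integral_congr_ae ?_
    filter_upwards [hPu.prod_left_ae] with y hy
    have := integral_Ioi_of_hasDerivAt_of_tendsto' (a := 0) (m := 0)
      (f := fun u => φ u * (φ (y + a * u) * Φ (c * u + k * y))) (f' := fun u => Pu (u, y))
      (fun u _ => ?_) hy ?_
    · simpa using this
    · convert! (hφ' u).mul (((hφ' (y + a * u)).comp u
        (((hasDerivAt_id u).const_mul a).const_add y)).mul ((hΦ' (c * u + k * y)).comp u
          (((hasDerivAt_id u).const_mul c).add_const (k * y)))) using 1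
      simp only [Pu, A, B, C, Function.comp_apply, id, Pi.mul_apply]
      ring
    · refine tendsto_gaussianPDFReal_mul_atTop_zero (M := 1) fun u => ?_
      rw [abs_mul]
      exact mul_le_one₀ (abs_gaussianPDFReal_zero_one_le_one _) (abs_nonneg _)
        (abs_cdf_le_one _ _)
  have hsum : A = fun p => a * Py p - Pu p + (c - a * k) * B p := by
    ext p
    simp only [Py, Pu]
    ring
  have hAB : ∫ p, A p ∂(ν.prod ν) = a * (∫ p, Py p ∂(ν.prod ν)) - (∫ p, Pu p ∂(ν.prod ν)) +
      (c - a * k) * ∫ p, B p ∂(ν.prod ν) := by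
    have hPyu : Integrable (fun p => a * Py p - Pu p) (ν.prod ν) := (hPy.const_mul a).sub hPu
    rw [hsum]
    beta_reduce
    rw [integral_add hPyu (hB.const_mul _), integral_sub (hPy.const_mul a) hPu,
      integral_const_mul, integral_const_mul]
  rw [hy, hu, integral_prod _ hA, integral_prod _ hB] at hAB
  simp only [A, B, ν] at hAB
  rw [hAB]
  ring

theorem integral_Ioi_integral_Ioi_gaussianPDFReal {a c k r m n : ℝ} (hr : 0 < r)
    (hk : r ^ 2 = 1 + k ^ 2) (hm : r * m = a + c * k) (hn : r * n = c - a * k) :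
    (c - a * k) * ∫ u in Ioi 0, ∫ y in Ioi 0, φ u * φ (y + a * u) * φ (c * u + k * y) =
      n * ∫ u in Ioi 0, φ u * φ (n * u) * Φ (-m * u) := by
  have hmn : m ^ 2 + n ^ 2 = a ^ 2 + c ^ 2 := by
    have : r ^ 2 * (m ^ 2 + n ^ 2) = r ^ 2 * (a ^ 2 + c ^ 2) := by
      rw [mul_add, ← mul_pow, ← mul_pow, hm, hn, hk]
      ring
    exact mul_left_cancel₀ (by positivity) this
  have h (u y : ℝ) : φ u * φ (y + a * u) * φ (c * u + k * y) =
      φ u * φ (n * u) * φ (r * y + m * u) := by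
    rw [mul_assoc, mul_assoc, gaussianPDFReal_zero_one_mul_mul (z := n * u) (w := r * y + m * u)]
    linear_combination -y ^ 2 * hk - 2 * y * u * hm - u ^ 2 * hmn
  simp_rw [h, integral_const_mul, integral_Ioi_gaussianPDFReal_zero_one_comp hr, ← hn]
  rw [← integral_const_mul, ← integral_const_mul]
  congr 1 with u
  field_simp

/-- For independent standard Gaussians `X`, `Y`, `Z`, the expectation of `max X 0` on the event
`Y ≤ -a X`, `ρ Y + s Z ≤ -b X`, as an integral over a quadrant. -/
theorem integral_max_mul_indicator_of_map_eq_prod_gaussianReal {Ω : Type*} [MeasurableSpace Ω]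
    {P : Measure Ω} {X Y Z : Ω → ℝ} (hX : Measurable X) (hY : Measurable Y) (hZ : Measurable Z)
    (h : P.map (fun ω => (X ω, Y ω, Z ω)) =
      (gaussianReal 0 1).prod ((gaussianReal 0 1).prod (gaussianReal 0 1)))
    (a b ρ : ℝ) {s : ℝ} (hs : 0 < s) :
    ∫ ω, max (X ω) 0 * {ω | Y ω ≤ -a * X ω}.indicator 1 ω *
      {ω | ρ * Y ω + s * Z ω ≤ -b * X ω}.indicator 1 ω ∂P =
    ∫ u in Ioi 0, ∫ y in Ioi 0,
      u * φ u * φ (y + a * u) * Φ ((ρ * a - b) / s * u + ρ / s * y) := by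
  let g := gaussianReal 0 1
  let F : ℝ × ℝ × ℝ → ℝ := fun p => max p.1 0 *
    ({q : ℝ × ℝ × ℝ | q.2.1 ≤ -a * q.1}.indicator 1 p) *
      ({q : ℝ × ℝ × ℝ | ρ * q.2.1 + s * q.2.2 ≤ -b * q.1}.indicator 1 p)
  have hmeas : Measurable F := by
    refine (Measurable.mul (by fun_prop) (measurable_one.indicator ?_)).mul
      (measurable_one.indicator ?_)
    · exact measurableSet_le (by fun_prop) (by fun_prop)
    · exact measurableSet_le (by fun_prop) (by fun_prop)
  have hind (t : Set (ℝ × ℝ × ℝ)) (p : ℝ × ℝ × ℝ) : |t.indicator (1 : ℝ × ℝ × ℝ → ℝ) p| ≤ 1 := by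
    by_cases h : p ∈ t <;> simp [h]
  have hF : Integrable F (g.prod (g.prod g)) := by
    have h1 : Integrable (fun u : ℝ => u) g :=
      (memLp_id_gaussianReal (μ := 0) (v := 1) 1).integrable le_rfl
    refine (h1.comp_fst (g.prod g)).mono hmeas.aestronglyMeasurable (ae_of_all _ fun p => ?_)
    simp only [F, norm_mul, norm_eq_abs]
    have h2 : |max p.1 0| ≤ |p.1| := by
      rw [abs_of_nonneg (le_max_right _ _)]
      exact max_le (le_abs_self _) (abs_nonneg _)
    calc |max p.1 0| * _ * _ ≤ |p.1| * 1 * 1 := by gcongr <;> exact hind _ _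
      _ = |p.1| := by ring
  have hz (u v : ℝ) : ∫ z, F (u, v, z) ∂g =
      max u 0 * (Iic (-a * u)).indicator (fun v => Φ ((-b * u - ρ * v) / s)) v := by
    have h1 : ∀ z, F (u, v, z) = max u 0 * (Iic (-a * u)).indicator 1 v *
        (Iic ((-b * u - ρ * v) / s)).indicator 1 z := fun z => by
      have : ρ * v + s * z ≤ -b * u ↔ z ≤ (-b * u - ρ * v) / s := by
        rw [le_div_iff₀ hs]
        constructor <;> intro h <;> linarith
      simp only [F, indicator_apply, mem_ofPred_eq, mem_Iic, this, Pi.one_apply]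
    simp_rw [h1]
    rw [integral_const_mul, integral_indicator_one measurableSet_Iic, ← cdf_eq_real]
    simp only [indicator_apply]
    split_ifs <;> simp [g]
  have hv (u : ℝ) : ∫ v, (Iic (-a * u)).indicator (fun v => Φ ((-b * u - ρ * v) / s)) v ∂g =
      ∫ y in Ioi 0, φ (y + a * u) * Φ ((ρ * a - b) / s * u + ρ / s * y) := by
    rw [integral_gaussianReal_eq_integral_smul one_ne_zero,
      ← integral_sub_left_eq_self _ volume (-a * u), ← integral_Ici_eq_integral_Ioi,
      ← integral_indicator measurableSet_Ici]
    congr 1 with y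
    by_cases h : 0 ≤ y
    · have h1 : φ (-a * u - y) = φ (y + a * u) := by
        rw [← gaussianPDFReal_zero_one_neg]
        ring_nf
      simp only [indicator_apply, mem_Iic, mem_Ici, h, if_true, sub_le_self_iff, smul_eq_mul, h1]
      congr 2
      ring
    · simp [h]
  have hF' : ∫ p, F p ∂(g.prod (g.prod g)) = ∫ u, max u 0 *
      (∫ y in Ioi 0, φ (y + a * u) * Φ ((ρ * a - b) / s * u + ρ / s * y)) ∂g := by
    rw [integral_prod _ hF]
    refine integral_congr_ae ?_
    filter_upwards [hF.prod_right_ae] with u hu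
    rw [integral_prod _ hu]
    simp_rw [hz]
    rw [integral_const_mul, hv]
  have hmap : ∫ ω, F (X ω, Y ω, Z ω) ∂P = ∫ p, F p ∂(g.prod (g.prod g)) := by
    rw [← h, integral_map (hX.prodMk (hY.prodMk hZ)).aemeasurable hmeas.aestronglyMeasurable]
  rw [hF', integral_gaussianReal_eq_integral_smul one_ne_zero] at hmap
  refine hmap.trans ?_
  rw [← integral_indicator measurableSet_Ioi]
  congr 1 with u
  by_cases hu : 0 < u
  · simp only [indicator_apply, mem_Ioi, hu, if_true, max_eq_left hu.le, mul_assoc,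
      integral_const_mul, smul_eq_mul]
    ring
  · simp [hu, max_eq_right (not_lt.1 hu)]

theorem arctan_cos_div_sin {θ : ℝ} (hθ : θ ∈ Ioo 0 π) : arctan (cos θ / sin θ) = π / 2 - θ := by
  rw [← sin_pi_div_two_sub θ, ← cos_pi_div_two_sub θ, ← tan_eq_sin_div_cos]
  exact arctan_tan (by linarith [hθ.2]) (by linarith [hθ.1])

open Classical in
/-- The edge-term expectation in the proof of Theorem 3.2: for a centered Gaussian
vector `(U, V, W)` with unit variances, `Cov(U,V) = Cov(U,W) = 0`, `Cov(V,W) = cos θ₃`,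
and `θ₁, θ₂, θ₃ ∈ (0, π)`,
`E[max(U,0) · 1_{cos θ₁ U + sin θ₁ V ≤ 0} · 1_{cos θ₂ U + sin θ₂ W ≤ 0}]`
equals the stated combination of arctangents. -/
theorem edge_term_expectation
    {Ω : Type*} [MeasureSpace Ω] [IsProbabilityMeasure (ℙ : Measure Ω)]
    (θ₁ θ₂ θ₃ : ℝ) (hθ₁ : θ₁ ∈ Set.Ioo 0 Real.pi) (hθ₂ : θ₂ ∈ Set.Ioo 0 Real.pi)
    (hθ₃ : θ₃ ∈ Set.Ioo 0 Real.pi)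
    (U V W : Ω → ℝ) (hU : Measurable U) (hV : Measurable V) (hW : Measurable W)
    (hGauss : ∀ t₁ t₂ t₃ : ℝ,
      Measure.map (fun ω => t₁ * U ω + t₂ * V ω + t₃ * W ω) ℙ =
        gaussianReal 0 (Real.toNNReal
          (t₁ ^ 2 + t₂ ^ 2 + t₃ ^ 2 + 2 * Real.cos θ₃ * t₂ * t₃))) :
    (∫ ω, max (U ω) 0 *
        (if Real.cos θ₁ * U ω + Real.sin θ₁ * V ω ≤ 0 then (1 : ℝ) else 0) *
        (if Real.cos θ₂ * U ω + Real.sin θ₂ * W ω ≤ 0 then (1 : ℝ) else 0)) =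
      (Real.pi - θ₃) / (2 * Real.pi) ^ ((3 : ℝ) / 2)
      - Real.cos θ₂ / Real.sqrt (2 * Real.pi) *
          (1 / 4 + 1 / (2 * Real.pi) * Real.arctan
            ((-Real.sin θ₂ * (Real.cos θ₁ / Real.sin θ₁) + Real.cos θ₃ * Real.cos θ₂)
              / Real.sin θ₃))
      - Real.cos θ₁ / Real.sqrt (2 * Real.pi) *
          (1 / 4 + 1 / (2 * Real.pi) * Real.arctan
            ((-Real.sin θ₁ * (Real.cos θ₂ / Real.sin θ₂) + Real.cos θ₃ * Real.cos θ₁)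
              / Real.sin θ₃)) := by
  have hs₁ : 0 < sin θ₁ := sin_pos_of_mem_Ioo hθ₁
  have hs₂ : 0 < sin θ₂ := sin_pos_of_mem_Ioo hθ₂
  have hs₃ : 0 < sin θ₃ := sin_pos_of_mem_Ioo hθ₃
  have h₁ := sin_sq_add_cos_sq θ₁
  have h₂ := sin_sq_add_cos_sq θ₂
  have h₃ := sin_sq_add_cos_sq θ₃
  set s₁ := sin θ₁
  set s₂ := sin θ₂
  set s₃ := sin θ₃
  set c₁ := cos θ₁
  set c₂ := cos θ₂
  set c₃ := cos θ₃
  let Z : Ω → ℝ := fun ω => (W ω - c₃ * V ω) / s₃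
  have hZ : Measurable Z := by fun_prop
  have hlaw : Measure.map (fun ω => (U ω, V ω, Z ω)) ℙ =
      (gaussianReal 0 1).prod ((gaussianReal 0 1).prod (gaussianReal 0 1)) := by
    refine map_prodMk_eq_prod_gaussianReal hU hV hZ fun r s t => ?_
    convert! hGauss r (s - t * c₃ / s₃) (t / s₃) using 2
    · ext ω
      simp only [Z]
      ring
    · congr 1
      field_simp
      linear_combination t ^ 2 * h₃
  have hJ := integral_max_mul_indicator_of_map_eq_prod_gaussianReal hU hV hZ hlaw
    (c₁ / s₁) (c₂ / s₂) c₃ hs₃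
  have hr₃ : (1 / s₃) ^ 2 = 1 + (c₃ / s₃) ^ 2 := by
    field_simp
    linarith
  have hr₁ : (1 / s₁) ^ 2 = 1 + (c₁ / s₁) ^ 2 := by
    field_simp
    linarith
  have hr₂ : (1 / s₂) ^ 2 = 1 + (-(c₂ / s₂)) ^ 2 := by
    field_simp
    linarith
  rw [integral_Ioi_integral_Ioi_mul_gaussianPDFReal,
    integral_Ioi_integral_Ioi_gaussianPDFReal (one_div_pos.2 hs₃) hr₃
      (m := (c₁ / s₁ - c₃ * (c₂ / s₂)) / s₃) (n := -(c₂ / s₂))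
      (by field_simp; linear_combination -c₁ * s₂ * h₃) (by field_simp; ring),
    integral_Ioi_gaussianPDFReal_mul_cdf,
    integral_Ioi_gaussianPDFReal_mul_gaussianPDFReal_mul_cdf (one_div_pos.2 hs₁) hr₁,
    integral_Ioi_gaussianPDFReal_mul_gaussianPDFReal_mul_cdf (one_div_pos.2 hs₂) hr₂,
    arctan_cos_div_sin hθ₃] at hJ
  have hφ0 : gaussianPDFReal 0 1 0 = 1 / √(2 * π) := by
    simp [gaussianPDFReal_zero_one_apply]
  have hpow : (2 * π) ^ ((3 : ℝ) / 2) = 2 * π * √(2 * π) := by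
    rw [sqrt_eq_rpow, show (3 : ℝ) / 2 = 1 + 1 / 2 by norm_num, rpow_add (by positivity),
      rpow_one]
  have harg₁ : (c₃ * (c₁ / s₁) - c₂ / s₂) / s₃ / (1 / s₁) =
      (-s₁ * (c₂ / s₂) + c₃ * c₁) / s₃ := by
    field_simp
    ring
  have harg₂ : -((c₁ / s₁ - c₃ * (c₂ / s₂)) / s₃) / (1 / s₂) =
      (-s₂ * (c₁ / s₁) + c₃ * c₂) / s₃ := by
    field_simp
    ring
  rw [harg₁, harg₂, hφ0] at hJ
  rw [hpow]
  have hint : ∀ ω, max (U ω) 0 * (if c₁ * U ω + s₁ * V ω ≤ 0 then (1 : ℝ) else 0) *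
      (if c₂ * U ω + s₂ * W ω ≤ 0 then (1 : ℝ) else 0) =
      max (U ω) 0 * {ω | V ω ≤ -(c₁ / s₁) * U ω}.indicator 1 ω *
        {ω | c₃ * V ω + s₃ * Z ω ≤ -(c₂ / s₂) * U ω}.indicator 1 ω := fun ω => by
    have e₁ : c₁ * U ω + s₁ * V ω ≤ 0 ↔ V ω ≤ -(c₁ / s₁) * U ω := by
      rw [show -(c₁ / s₁) * U ω = -(c₁ * U ω) / s₁ by ring, le_div_iff₀ hs₁]
      constructor <;> intro h <;> linarith
    have e₂ : c₂ * U ω + s₂ * W ω ≤ 0 ↔ c₃ * V ω + s₃ * Z ω ≤ -(c₂ / s₂) * U ω := by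
      rw [show c₃ * V ω + s₃ * Z ω = W ω by simp only [Z]; field_simp; ring,
        show -(c₂ / s₂) * U ω = -(c₂ * U ω) / s₂ by ring, le_div_iff₀ hs₂]
      constructor <;> intro h <;> linarith
    simp only [indicator_apply, mem_ofPred_eq, e₁, e₂, Pi.one_apply]
  simp_rw [hint]
  rw [hJ]
  generalize arctan ((-s₁ * (c₂ / s₂) + c₃ * c₁) / s₃) = A₁
  generalize arctan ((-s₂ * (c₁ / s₁) + c₃ * c₂) / s₃) = A₂
  field_simp
  ring
end

section
/- Let r, u ∈ ℝ, let Σ(r) be the 3×3 matrix with rows (12r−1, 0, 4r−1), (0, 4r, 0), (4r−1, 0, 12r−1), let A be the 3×3 matrix with rows (0, 0, 1/2), (0, −1, 0), (1/2, 0, 0), and let b = (−u, 0, −u)ᵀ. For every z ∈ ℂ with det(I₃ − z·Σ(r)·A) ≠ 0, one has bᵀ·(I₃ − z·Σ(r)·A)^{−1}·Σ(r)·b = 4u²(8r − 1)/(1 − (8r − 1)·z). -/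
open Matrix

/-- Quadratic-form identity in the proof of Theorem 4.1: with `Σ(r)`, `A` and
`b = (-u, 0, -u)ᵀ` as in the paper, for `z` with `det(I₃ - z Σ(r) A) ≠ 0`,
`bᵀ (I₃ - z Σ(r) A)⁻¹ Σ(r) b = 4u²(8r-1)/(1 - (8r-1)z)`. -/
theorem quadratic_form_resolvent (r u : ℝ) (z : ℂ)
    (S : Matrix (Fin 3) (Fin 3) ℂ)
    (hS : S = !![(12 * (r : ℂ) - 1), 0, 4 * (r : ℂ) - 1;
                 0, 4 * (r : ℂ), 0;
                 4 * (r : ℂ) - 1, 0, 12 * (r : ℂ) - 1])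
    (A : Matrix (Fin 3) (Fin 3) ℂ)
    (hA : A = !![(0 : ℂ), 0, 1 / 2;
                 0, -1, 0;
                 1 / 2, 0, 0])
    (b : Fin 3 → ℂ) (hb : b = ![-(u : ℂ), 0, -(u : ℂ)])
    (hdet : Matrix.det ((1 : Matrix (Fin 3) (Fin 3) ℂ) - z • (S * A)) ≠ 0) :
    b ⬝ᵥ (((1 : Matrix (Fin 3) (Fin 3) ℂ) - z • (S * A))⁻¹ *ᵥ (S *ᵥ b)) =
      4 * (u : ℂ) ^ 2 * (8 * (r : ℂ) - 1) / (1 - (8 * (r : ℂ) - 1) * z) := by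
  set M := (1 : Matrix (Fin 3) (Fin 3) ℂ) - z • (S * A) with hM
  have hdet_eq : M.det = (1 - (8 * (r : ℂ) - 1) * z) * (1 + 4 * r * z) ^ 2 := by
    rw [hM, hS, hA, Matrix.det_fin_three]
    simp
    ring
  have hden : 1 - (8 * (r : ℂ) - 1) * z ≠ 0 := by
    intro h
    exact hdet (by rw [hdet_eq, h, zero_mul])
  have hSb : S *ᵥ b = (2 * (8 * (r : ℂ) - 1)) • b := by
    rw [hS, hb]
    ext i
    fin_cases i <;> simp [Matrix.mulVec, dotProduct, Fin.sum_univ_three] <;> ring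
  have hAb : A *ᵥ b = (1 / 2 : ℂ) • b := by
    rw [hA, hb]
    ext i
    fin_cases i <;> simp [Matrix.mulVec, dotProduct, Fin.sum_univ_three]
  have hMb : M *ᵥ b = (1 - (8 * (r : ℂ) - 1) * z) • b := by
    rw [hM, Matrix.sub_mulVec, Matrix.one_mulVec, Matrix.smul_mulVec, ← Matrix.mulVec_mulVec,
      hAb, Matrix.mulVec_smul, hSb]
    module
  have hinv : M⁻¹ *ᵥ b = (1 - (8 * (r : ℂ) - 1) * z)⁻¹ • b := by
    have hb_eq : b = M *ᵥ ((1 - (8 * (r : ℂ) - 1) * z)⁻¹ • b) := by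
      rw [Matrix.mulVec_smul, hMb, smul_smul, inv_mul_cancel₀ hden, one_smul]
    conv_lhs => rw [hb_eq]
    rw [Matrix.mulVec_mulVec, Matrix.nonsing_inv_mul _ (isUnit_iff_ne_zero.mpr hdet),
      Matrix.one_mulVec]
  have hbb : b ⬝ᵥ b = 2 * (u : ℂ) ^ 2 := by
    rw [hb]
    simp [dotProduct, Fin.sum_univ_three]
    ring
  rw [hSb, Matrix.mulVec_smul, hinv, dotProduct_smul, dotProduct_smul, hbb, smul_eq_mul,
    smul_eq_mul]
  ring
end
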